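/- Every finite group admits a finite just finite presentation: for every finite group G there exist a finite type X and a finite set R of elements of the free group on X such that G is isomorphic to the presented group ⟨X | R⟩, and for every r ∈ R the presented group ⟨X | R \ {r}⟩ is infinite. -/

import Mathlib

open Monoid in
/-- A reduced word of length `2 (n+1)` alternating between two copies of `K`. -/
def altWord {K : Type} [Group K] (a b : K) (ha : a ≠ 1) (hb : b ≠ 1) :
    ℕ → CoprodI.NeWord (fun _ : Bool => K) false true
  | 0 => (CoprodI.NeWord.singleton (M := fun _ : Bool => K) (i := false) a ha).append
      (by decide) (CoprodI.NeWord.singleton (M := fun _ : Bool => K) (i := true) b hb)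
  | n + 1 => (altWord a b ha hb n).append (by decide) (altWord a b ha hb 0)

open Monoid in
lemma altWord_length {K : Type} [Group K] (a b : K) (ha : a ≠ 1) (hb : b ≠ 1) (n : ℕ) :
    (altWord a b ha hb n).toList.length = 2 * (n + 1) := by
  induction n with
  | zero => simp [altWord]
  | succ n ih => simp [altWord, ih]; omega

open Monoid in
lemma altWord_prod {K : Type} [Group K] (a b : K) (ha : a ≠ 1) (hb : b ≠ 1) (n : ℕ) :
    (altWord a b ha hb n).prod =
      ((CoprodI.of (M := fun _ : Bool => K) (i := false) a) *
        (CoprodI.of (M := fun _ : Bool => K) (i := true) b)) ^ (n + 1) := by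
  induction n with
  | zero => simp [altWord]
  | succ n ih => rw [pow_succ, ← ih]; simp [altWord]

open Monoid in
lemma coprodI_pow_injective {K : Type} [Group K] (a b : K) (ha : a ≠ 1) (hb : b ≠ 1) :
    Function.Injective fun n : ℕ =>
      ((CoprodI.of (M := fun _ : Bool => K) (i := false) a) *
        (CoprodI.of (M := fun _ : Bool => K) (i := true) b)) ^ (n + 1) := by
  classical
  intro m n h
  simp only [← altWord_prod a b ha hb] at h
  have h2 : (altWord a b ha hb m).toWord = (altWord a b ha hb n).toWord :=
    CoprodI.Word.equiv.symm.injective h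
  have h3 := congrArg (fun w => w.toList.length) h2
  change (altWord a b ha hb m).toList.length = (altWord a b ha hb n).toList.length at h3
  rw [altWord_length, altWord_length] at h3
  omega

/-- The exponents `2` and `3`. -/
def expo (b : Bool) : ℕ := if b then 2 else 3

/-- The relators `g h (gh)⁻¹ = y ^ 2` and `g h (gh)⁻¹ = y ^ 3`, with `y = y_(g,h)`. -/
def jfRel (G : Type) [Group G] (i : (G × G) × Bool) : FreeGroup (G ⊕ (G × G)) :=
  FreeGroup.of (Sum.inl i.1.1) * FreeGroup.of (Sum.inl i.1.2) *
    (FreeGroup.of (Sum.inl (i.1.1 * i.1.2)))⁻¹ * (FreeGroup.of (Sum.inr i.1) ^ expo i.2)⁻¹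

open Monoid in
lemma jf_infinite (G : Type) [Group G] [Nontrivial G] (i : (G × G) × Bool) :
    Infinite (PresentedGroup (Set.range (jfRel G) \ {jfRel G i})) := by
  classical
  obtain ⟨p, b⟩ := i
  obtain ⟨a, ha⟩ := exists_ne (1 : G)
  let K := G × Multiplicative (ZMod (expo (!b)))
  let y : K := (1, Multiplicative.ofAdd 1)
  have hy : y ≠ 1 := by
    intro h
    have h' : Multiplicative.ofAdd (1 : ZMod (expo (!b))) = 1 := congrArg Prod.snd h
    revert h'
    cases b <;> decide
  have hyp : y ^ expo (!b) = 1 := by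
    ext
    · change (1 : G) ^ expo (!b) = 1
      exact one_pow _
    · change (Multiplicative.ofAdd (1 : ZMod (expo (!b)))) ^ expo (!b) = 1
      rw [← ofAdd_nsmul]; simp
  let ι : Bool → K →* CoprodI (fun _ : Bool => K) := fun i =>
    CoprodI.of (M := fun _ : Bool => K) (i := i)
  let f : G ⊕ (G × G) → CoprodI (fun _ : Bool => K) :=
    Sum.elim (fun g => ι false (g, 1)) (fun q => if q = p then ι true y else 1)
  have hf : ∀ r ∈ Set.range (jfRel G) \ {jfRel G (p, b)}, FreeGroup.lift f r = 1 := by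
    rintro _ ⟨⟨⟨q, c⟩, rfl⟩, hne⟩
    have h1 : ι false (q.1, 1) * ι false (q.2, 1) * (ι false (q.1 * q.2, 1))⁻¹ = 1 := by
      rw [mul_inv_eq_one, ← map_mul]
      congr 1
      exact Prod.ext rfl (one_mul _)
    have h2 : f (Sum.inr q) ^ expo c = 1 := by
      by_cases hq : q = p
      · have hc : c = !b := by
          by_contra hc
          apply hne
          have : c = b := by revert hc; cases b <;> cases c <;> simp
          rw [hq, this]; rfl
        simp only [f, Sum.elim_inr, if_pos hq, hc]
        rw [← map_pow, hyp, map_one]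
      · simp [f, hq]
    simp only [jfRel, map_mul, map_inv, map_pow, FreeGroup.lift_apply_of, h2]
    simpa [f] using h1
  let φ := PresentedGroup.toGroup hf
  let w : PresentedGroup (Set.range (jfRel G) \ {jfRel G (p, b)}) :=
    PresentedGroup.of (Sum.inl a) * PresentedGroup.of (Sum.inr p)
  have hw : φ w = ι false (a, 1) * ι true y := by
    simp only [φ, w, map_mul, PresentedGroup.toGroup.of]
    simp [f]
  have hinj := coprodI_pow_injective (K := K) (a, 1) y (by simpa [K, Prod.ext_iff] using ha) hy
  refine Infinite.of_injective (fun n : ℕ => w ^ (n + 1)) ?_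
  intro m n h
  apply hinj
  have h' := congrArg φ h
  simpa only [map_pow, hw] using h'

lemma jf_equiv (G : Type) [Group G] :
    Nonempty (G ≃* PresentedGroup (Set.range (jfRel G))) := by
  have hrel : ∀ i, PresentedGroup.mk (Set.range (jfRel G)) (jfRel G i) = 1 := fun i =>
    (QuotientGroup.eq_one_iff _).2 (Subgroup.subset_normalClosure ⟨i, rfl⟩)
  have key : ∀ g h : G,
      (PresentedGroup.of (Sum.inl g) * PresentedGroup.of (Sum.inl h) *
        (PresentedGroup.of (Sum.inl (g * h)))⁻¹ : PresentedGroup (Set.range (jfRel G))) = 1 ∧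
      (PresentedGroup.of (Sum.inr (g, h)) : PresentedGroup (Set.range (jfRel G))) = 1 := by
    intro g h
    have e2 := hrel ((g, h), true)
    have e3 := hrel ((g, h), false)
    simp only [jfRel, map_mul, map_inv, map_pow, expo] at e2 e3
    rw [mul_inv_eq_one] at e2 e3
    have hy : (PresentedGroup.of (Sum.inr (g, h)) : PresentedGroup (Set.range (jfRel G))) = 1 := by
      have e := e2.symm.trans e3
      simp only [if_true, Bool.false_eq_true, if_false] at e
      rw [pow_succ _ 2] at e
      exact left_eq_mul.1 e
    refine ⟨?_, hy⟩
    refine e2.trans ?_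
    change (PresentedGroup.of (Sum.inr (g, h)) : PresentedGroup (Set.range (jfRel G))) ^ _ = 1
    rw [hy, one_pow]
  let ψ : G →* PresentedGroup (Set.range (jfRel G)) :=
    MonoidHom.mk' (fun g => PresentedGroup.of (Sum.inl g))
      (fun g h => (mul_inv_eq_one.1 (key g h).1).symm)
  have hf : ∀ r ∈ Set.range (jfRel G),
      FreeGroup.lift (Sum.elim id (fun _ => 1) : G ⊕ (G × G) → G) r = 1 := by
    rintro _ ⟨i, rfl⟩
    simp [jfRel]
  refine ⟨MonoidHom.toMulEquiv ψ (PresentedGroup.toGroup hf) ?_ ?_⟩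
  · ext g
    simp [ψ, PresentedGroup.toGroup.of]
  · apply PresentedGroup.ext
    rintro (g | ⟨g, h⟩)
    · simp [ψ, PresentedGroup.toGroup.of]
    · simp [PresentedGroup.toGroup.of, (key g h).2]

/-- Every finite group admits a finite just finite presentation: there are a finite
type `X` and a finite set `R` of relators in `FreeGroup X` such that `G ≃* ⟨X | R⟩`
and for each `r ∈ R` the group `⟨X | R \ {r}⟩` is infinite. -/
theorem stmt_0 (G : Type) [Group G] [Finite G] :
    ∃ (X : Type) (_ : Finite X) (R : Set (FreeGroup X)), R.Finite ∧
      Nonempty (G ≃* PresentedGroup R) ∧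
      ∀ r ∈ R, Infinite (PresentedGroup (R \ {r})) := by
  rcases subsingleton_or_nontrivial G with hG | hG
  · refine ⟨Empty, inferInstance, ∅, Set.finite_empty, ?_, by simp⟩
    have : Subsingleton (PresentedGroup (∅ : Set (FreeGroup Empty))) :=
      (PresentedGroup.mk_surjective _).subsingleton
    exact ⟨{ toFun := fun _ => 1, invFun := fun _ => 1,
             left_inv := fun _ => Subsingleton.elim _ _,
             right_inv := fun _ => Subsingleton.elim _ _,
             map_mul' := fun _ _ => Subsingleton.elim _ _ }⟩
  · refine ⟨G ⊕ (G × G), inferInstance, Set.range (jfRel G), Set.finite_range _, jf_equiv G, ?_⟩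
    rintro _ ⟨i, rfl⟩
    exact jf_infinite G i
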